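/- Suppose the feasible set of the K-base-station spectrum allocation problem is nonempty, and let M ⊆ S be a nonempty subset with |M| = m. Then there exists a feasible allocation x* minimizing the objective f over all feasible allocations such that the number of nonempty subsets B ⊆ M with x*(B) ≠ 0 is at most m; that is, the spectrum used exclusively by stations in M is divided into at most m segments. -/

import Mathlib

open Finset

noncomputable section

/-- Service rate of base station `i` induced by spectrum allocation `x`,
    where `s i B` is the spectral efficiency of station `i` on spectrum shared by `B`. -/
def rate {K : ℕ} (s : Fin K → Finset (Fin K) → ℝ) (x : Finset (Fin K) → ℝ) (i : Fin K) : ℝ :=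
  ∑ B : Finset (Fin K), s i B * x B

/-- A feasible spectrum allocation: nonnegative, sums to one, and every queue is stable. -/
def Feasible {K : ℕ} (s : Fin K → Finset (Fin K) → ℝ) (lam : Fin K → ℝ)
    (x : Finset (Fin K) → ℝ) : Prop :=
  (∀ B, 0 ≤ x B) ∧ (∑ B : Finset (Fin K), x B = 1) ∧ (∀ i, lam i < rate s x i)

/-- Conservative weighted mean packet sojourn time. -/
def obj {K : ℕ} (s : Fin K → Finset (Fin K) → ℝ) (lam : Fin K → ℝ)
    (x : Finset (Fin K) → ℝ) : ℝ :=
  ∑ i : Fin K, (lam i / ∑ j : Fin K, lam j) / (rate s x i - lam i)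

/-- The nonempty subsets of `M` to which `x` assigns spectrum. -/
def exclusiveSegments {K : ℕ} (M : Finset (Fin K)) (x : Finset (Fin K) → ℝ) :
    Finset (Finset (Fin K)) :=
  univ.filter fun B => B ⊆ M ∧ B ≠ ∅ ∧ x B ≠ 0

/-- More than `M.card` sets contained in `M` satisfy a nontrivial linear relation
that preserves all rates and does not increase the total bandwidth. -/
lemma exists_rate_preserving_direction {K : ℕ} (s : Fin K → Finset (Fin K) → ℝ)
    (hs0 : ∀ i B, i ∉ B → s i B = 0) (M : Finset (Fin K)) (T : Finset (Finset (Fin K)))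
    (hT : ∀ B ∈ T, B ⊆ M) (hcard : M.card < T.card) :
    ∃ d : Finset (Fin K) → ℝ, d ≠ 0 ∧ (∀ B, B ∉ T → d B = 0) ∧
      (∀ i, rate s d i = 0) ∧ ∑ B, d B ≤ 0 := by
  suffices h : ∃ d : Finset (Fin K) → ℝ, d ≠ 0 ∧ (∀ B, B ∉ T → d B = 0) ∧
      ∀ i, rate s d i = 0 by
    obtain ⟨d, hd, hd0, hr⟩ := h
    rcases le_total (∑ B, d B) 0 with h | h
    · exact ⟨d, hd, hd0, hr, h⟩
    · refine ⟨-d, neg_ne_zero.2 hd, fun B hB => by simp [hd0 B hB], fun i => ?_, by simpa using h⟩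
      have := hr i
      simp only [rate] at this
      simp [rate, this]
  let A : Matrix M T ℝ := fun i B => s i B
  have hker : LinearMap.ker A.mulVecLin ≠ ⊥ :=
    LinearMap.ker_ne_bot_of_finrank_lt (by simpa using hcard)
  obtain ⟨v, hv, hv0⟩ := (Submodule.ne_bot_iff _).1 hker
  refine ⟨fun B => if h : B ∈ T then v ⟨B, h⟩ else 0, fun h => hv0 ?_,
    fun B hB => by simp [hB], fun i => ?_⟩
  · ext B
    simpa using congrFun h B
  · have hsum : rate s (fun B => if h : B ∈ T then v ⟨B, h⟩ else 0) i
        = ∑ B : T, s i B * v B := by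
      rw [rate, ← Finset.sum_subset (Finset.subset_univ T) fun B _ hB => by simp [hB],
        ← Finset.sum_coe_sort T]
      simp
    rw [hsum]
    by_cases hi : i ∈ M
    · exact congrFun (LinearMap.mem_ker.1 hv) ⟨i, hi⟩
    · exact Finset.sum_eq_zero fun B _ => by
        rw [hs0 i B fun h => hi (hT B B.2 h), zero_mul]

/-- One segment can be eliminated, without changing the rates, as long as there are more than
`M.card` of them; the bandwidth that becomes free is left unused. -/
lemma exists_fewer_exclusiveSegments {K : ℕ} (s : Fin K → Finset (Fin K) → ℝ)
    (hs0 : ∀ i B, i ∉ B → s i B = 0) (M : Finset (Fin K)) (x : Finset (Fin K) → ℝ)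
    (hx : ∀ B, 0 ≤ x B) (hcard : M.card < (exclusiveSegments M x).card) :
    ∃ y : Finset (Fin K) → ℝ, (∀ B, 0 ≤ y B) ∧ ∑ B, y B = ∑ B, x B ∧
      (∀ i, rate s y i = rate s x i) ∧
      (exclusiveSegments M y).card < (exclusiveSegments M x).card := by
  set T := exclusiveSegments M x with hTdef
  have hT : ∀ B, B ∈ T ↔ B ⊆ M ∧ B ≠ ∅ ∧ x B ≠ 0 := fun B => by
    simp [hTdef, exclusiveSegments]
  obtain ⟨d, hd, hd0, hr, hsum⟩ := exists_rate_preserving_direction s hs0 M T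
    (fun B hB => ((hT B).1 hB).1) hcard
  have hneg : (univ.filter fun B => d B < 0).Nonempty := by
    by_contra h
    have hnn : ∀ B, 0 ≤ d B := by simpa [Finset.filter_eq_empty_iff] using h
    have h0 := (Finset.sum_eq_zero_iff_of_nonneg fun B _ => hnn B).1
      (le_antisymm hsum (Finset.sum_nonneg fun B _ => hnn B))
    exact hd (funext fun B => h0 B (mem_univ B))
  obtain ⟨C, hC, hmin⟩ := Finset.exists_min_image _ (fun B => x B / -d B) hneg
  have hdC : d C < 0 := by simpa using hC
  set t := x C / -d C with ht
  have ht0 : 0 ≤ t := div_nonneg (hx C) (by linarith)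
  have hstep : ∀ B, 0 ≤ x B + t * d B := fun B => by
    rcases lt_or_ge (d B) 0 with h | h
    · have := hmin B (by simpa using h)
      rw [le_div_iff₀ (by linarith)] at this
      linarith
    · exact add_nonneg (hx B) (mul_nonneg ht0 h)
  have hfree : 0 ≤ -(t * ∑ B, d B) := by nlinarith
  refine ⟨fun B => x B + t * d B + if B = ∅ then -(t * ∑ B, d B) else 0, fun B => ?_, ?_,
    fun i => ?_, Finset.card_lt_card (Finset.ssubset_iff_of_subset ?_ |>.2 ⟨C, ?_, ?_⟩)⟩
  · have := hstep B
    dsimp only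
    split_ifs <;> linarith
  · simp [Finset.sum_add_distrib, Finset.mul_sum]
  · have hri := hr i
    have hempty : s i ∅ = 0 := hs0 i ∅ (by simp)
    simp only [rate] at hri ⊢
    simp only [mul_add, Finset.sum_add_distrib, mul_left_comm _ t, ← Finset.mul_sum, hri]
    simp [hempty]
  · intro B hB
    simp only [exclusiveSegments, mem_filter, mem_univ, true_and] at hB
    refine (hT B).2 ⟨hB.1, hB.2.1, fun h => hB.2.2 ?_⟩
    have : B ∉ T := fun h' => ((hT B).1 h').2.2 h
    simp [h, hd0 B this, hB.2.1]
  · by_contra h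
    exact hdC.ne (hd0 C h)
  · have hCT : C ∈ T := by
      by_contra h
      exact hdC.ne (hd0 C h)
    have hz : x C + t * d C = 0 := by
      rw [ht]
      field_simp [hdC.ne]
      ring
    simp [exclusiveSegments, ((hT C).1 hCT).2.1, hz]

/-- Every allocation can be replaced by one with the same rates and at most `M.card` segments
used exclusively by stations in `M`. -/
lemma exists_card_exclusiveSegments_le {K : ℕ} (s : Fin K → Finset (Fin K) → ℝ)
    (hs0 : ∀ i B, i ∉ B → s i B = 0) (M : Finset (Fin K)) (x : Finset (Fin K) → ℝ)
    (hx : ∀ B, 0 ≤ x B) :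
    ∃ y : Finset (Fin K) → ℝ, (∀ B, 0 ≤ y B) ∧ ∑ B, y B = ∑ B, x B ∧
      (∀ i, rate s y i = rate s x i) ∧ (exclusiveSegments M y).card ≤ M.card := by
  induction hn : (exclusiveSegments M x).card using Nat.strong_induction_on generalizing x with
  | _ n ih =>
    rcases le_or_gt n M.card with h | h
    · exact ⟨x, hx, rfl, fun _ => rfl, hn.trans_le h⟩
    · obtain ⟨y, hy, hys, hyr, hyc⟩ := exists_fewer_exclusiveSegments s hs0 M x hx (hn ▸ h)
      obtain ⟨z, hz, hzs, hzr, hzc⟩ := ih _ (hn ▸ hyc) y hy rfl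
      exact ⟨z, hz, hzs.trans hys, fun i => (hzr i).trans (hyr i), hzc⟩

lemma continuous_rate {K : ℕ} (s : Fin K → Finset (Fin K) → ℝ) (i : Fin K) :
    Continuous fun x => rate s x i := by
  unfold rate
  fun_prop

/-- The objective attains its minimum on the feasible set if the latter is nonempty. -/
lemma exists_feasible_minimizer {K : ℕ} (hK : 1 ≤ K) (s : Fin K → Finset (Fin K) → ℝ)
    (lam : Fin K → ℝ) (hlam : ∀ i, 0 < lam i) (hne : ∃ x, Feasible s lam x) :
    ∃ x, Feasible s lam x ∧ ∀ y, Feasible s lam y → obj s lam x ≤ obj s lam y := by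
  obtain ⟨x₀, hx₀⟩ := hne
  have : Nonempty (Fin K) := ⟨⟨0, hK⟩⟩
  have hw : ∀ i, 0 < lam i / ∑ j, lam j := fun i =>
    div_pos (hlam i) (Finset.sum_pos (fun j _ => hlam j) Finset.univ_nonempty)
  have hterm : ∀ x, Feasible s lam x → ∀ i,
      0 < (lam i / ∑ j, lam j) / (rate s x i - lam i) := fun x hx i =>
    div_pos (hw i) (sub_pos.2 (hx.2.2 i))
  set c := obj s lam x₀ with hc
  have hc0 : 0 < c := Finset.sum_pos (fun i _ => hterm x₀ hx₀ i) Finset.univ_nonempty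
  let D : Set (Finset (Fin K) → ℝ) :=
    stdSimplex ℝ (Finset (Fin K)) ∩
      {x | ∀ i, (lam i / ∑ j, lam j) / c ≤ rate s x i - lam i}
  have hDcompact : IsCompact D := by
    refine (isCompact_stdSimplex ℝ (Finset (Fin K))).inter_right ?_
    simp only [Set.ofPred_forall]
    exact isClosed_iInter fun i =>
      isClosed_le continuous_const ((continuous_rate s i).sub continuous_const)
  have hDpos : ∀ x ∈ D, ∀ i, 0 < rate s x i - lam i := fun x hx i =>
    (div_pos (hw i) hc0).trans_le (hx.2 i)
  have hDfeas : ∀ x ∈ D, Feasible s lam x := fun x hx =>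
    ⟨hx.1.1, hx.1.2, fun i => sub_pos.1 (hDpos x hx i)⟩
  have hmem : ∀ x, Feasible s lam x → obj s lam x ≤ c → x ∈ D := fun x hx hxc => by
    refine ⟨⟨hx.1, hx.2.1⟩, fun i => ?_⟩
    rw [div_le_comm₀ hc0 (sub_pos.2 (hx.2.2 i))]
    exact (Finset.single_le_sum (fun j _ => (hterm x hx j).le) (Finset.mem_univ i)).trans hxc
  have hcont : ContinuousOn (obj s lam) D := by
    unfold obj
    exact continuousOn_finsetSum _ fun i _ => continuousOn_const.div
      ((continuous_rate s i).sub continuous_const).continuousOn fun x hx => (hDpos x hx i).ne'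
  obtain ⟨x, hxD, hxmin⟩ := hDcompact.exists_isMinOn ⟨x₀, hmem x₀ hx₀ le_rfl⟩ hcont
  refine ⟨x, hDfeas x hxD, fun y hy => ?_⟩
  rcases le_total (obj s lam y) c with h | h
  · exact hxmin (hmem y hy h)
  · exact (hxmin (hmem x₀ hx₀ le_rfl)).trans h

/-- If the feasible set is nonempty and M ⊆ S has m elements,
some minimizer of the objective uses at most m segments exclusively among stations in M. -/
theorem optimal_at_most_m_segments_in_subset {K : ℕ} (hK : 1 ≤ K)
    (s : Fin K → Finset (Fin K) → ℝ)
    (hs : ∀ i B, 0 ≤ s i B)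
    (hs0 : ∀ i B, i ∉ B → s i B = 0)
    (lam : Fin K → ℝ) (hlam : ∀ i, 0 < lam i)
    (hne : ∃ x, Feasible s lam x)
    (M : Finset (Fin K)) (hM : M.Nonempty) :
    ∃ xstar, Feasible s lam xstar ∧
      (∀ x, Feasible s lam x → obj s lam xstar ≤ obj s lam x) ∧
      {B : Finset (Fin K) | B ⊆ M ∧ B ≠ ∅ ∧ xstar B ≠ 0}.ncard ≤ M.card := by
  obtain ⟨x, hx, hmin⟩ := exists_feasible_minimizer hK s lam hlam hne
  obtain ⟨y, hy, hys, hyr, hyc⟩ := exists_card_exclusiveSegments_le s hs0 M x hx.1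
  have hobj : obj s lam y = obj s lam x := by simp only [obj, hyr]
  refine ⟨y, ⟨hy, hys.trans hx.2.1, fun i => (hyr i).symm ▸ hx.2.2 i⟩,
    fun z hz => hobj.trans_le (hmin z hz), ?_⟩
  rw [← Set.ncard_coe_finset] at hyc
  simpa [exclusiveSegments] using hyc
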